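/- Let X be a finite data domain, n ≥ 1, η > 0, γ > 0, let q : X → [0,1] be a query, and let x ∈ X be a fixed record. For a dataset D ∈ X^n define A_D = q(D) − q(x) and the acceptance probability p(D) = e^{−η−γ} · exp(−η·A_D). Then the Bernoulli mechanism D ↦ Bernoulli(p(D)) is ε-differentially private for ε = max{η/n, η/(γn)}: for any neighboring datasets D, D′ ∈ X^n (differing in one entry), p(D) ≤ e^ε · p(D′) and 1 − p(D) ≤ e^ε · (1 − p(D′)). -/

import Mathlib

/-- Changing one entry of a tuple changes the sum of a `[0, 1]`-valued function over it
by at most one. -/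
theorem sum_comp_le_sum_comp_add_one_of_eq_off_index {ι X : Type*} [Fintype ι]
    {q : X → ℝ} (hq : ∀ x, q x ∈ Set.Icc (0 : ℝ) 1) {D D' : ι → X} {i : ι}
    (h : ∀ j, j ≠ i → D j = D' j) :
    ∑ k, q (D k) ≤ ∑ k, q (D' k) + 1 := by
  classical
  rw [← Finset.add_sum_erase _ (fun k => q (D k)) (Finset.mem_univ i),
    ← Finset.add_sum_erase _ (fun k => q (D' k)) (Finset.mem_univ i),
    Finset.sum_congr rfl fun j hj => congrArg q (h j (Finset.ne_of_mem_erase hj))]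
  linarith [(hq (D i)).2, (hq (D' i)).1]

/-- On `[γ, ∞)` the function `u ↦ log (1 - exp (-u))` grows with slope at most `1 / γ`. -/
theorem one_sub_exp_neg_le_exp_mul {γ δ ε u v : ℝ} (hε : 0 ≤ ε)
    (hδ : δ ≤ γ * ε) (hγv : γ ≤ v) (huv : u ≤ v + δ) (hv : 0 ≤ v) :
    1 - Real.exp (-u) ≤ Real.exp ε * (1 - Real.exp (-v)) := by
  have hpos : 0 < Real.exp (-v) := Real.exp_pos _
  have hle : Real.exp (-v) ≤ 1 := Real.exp_le_one_iff.2 (by linarith)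
  have htangent : Real.exp (-v) * (1 + (v - u)) ≤ Real.exp (-u) := by
    have hsplit : Real.exp (-u) = Real.exp (-v) * Real.exp (v - u) := by
      rw [← Real.exp_add]; ring_nf
    rw [hsplit]
    gcongr
    linarith [Real.add_one_le_exp (v - u)]
  have hslope : Real.exp (-v) * (1 + γ) ≤ 1 := by
    calc Real.exp (-v) * (1 + γ) ≤ Real.exp (-v) * Real.exp v := by
          gcongr
          linarith [Real.add_one_le_exp v]
      _ = 1 := by rw [← Real.exp_add]; simp
  have hdiff : Real.exp (-v) * (u - v) ≤ Real.exp (-v) * (γ * ε) := by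
    gcongr
    linarith
  have hfactor : (1 + ε) * (1 - Real.exp (-v)) ≤ Real.exp ε * (1 - Real.exp (-v)) :=
    mul_le_mul_of_nonneg_right (by linarith [Real.add_one_le_exp ε]) (by linarith)
  nlinarith [mul_le_mul_of_nonneg_right hslope hε]

/-- (Rejection sampling privacy, Lemma `good-samples`.)
The Bernoulli mechanism that accepts with probability
`p(D) = e^{−η−γ}·exp(−η·(q(D) − q(x)))` is `ε`-differentially private for
`ε = max{η/n, η/(γn)}`: for neighboring datasets both the acceptance and the rejection
probabilities change by a factor of at most `e^ε`. -/
theorem rejection_step_privacy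
    {X : Type*} [Fintype X]
    (n : ℕ) (hn : 1 ≤ n)
    (q : X → ℝ) (hq : ∀ x, q x ∈ Set.Icc (0 : ℝ) 1)
    (x : X) (η γ : ℝ) (hη : 0 < η) (hγ : 0 < γ)
    -- the acceptance probability `p(D) = e^{−η−γ}·exp(−η·A_D)` with `A_D = q(D) − q(x)`
    (p : (Fin n → X) → ℝ)
    (hp : ∀ D : Fin n → X,
      p D = Real.exp (-η - γ) *
              Real.exp (-η * ((1 / (n : ℝ)) * (∑ k, q (D k)) - q x)))
    (ε : ℝ) (hε : ε = max (η / (n : ℝ)) (η / (γ * (n : ℝ)))) :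
    ∀ D D' : Fin n → X, (∃ i, ∀ j, j ≠ i → D j = D' j) →
      p D ≤ Real.exp ε * p D' ∧ 1 - p D ≤ Real.exp ε * (1 - p D') := by
  rintro D D' ⟨i, hi⟩
  have hn0 : (0 : ℝ) < n := by exact_mod_cast hn
  have hεn : η / n ≤ ε := hε ▸ le_max_left _ _
  have hεγ : η / n ≤ γ * ε := by
    calc η / n = γ * (η / (γ * n)) := by field_simp
      _ ≤ γ * ε := by
        gcongr
        exact hε ▸ le_max_right _ _
  have hε0 : 0 ≤ ε := (div_pos hη hn0).le.trans hεn
  have hpu : ∀ E : Fin n → X,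
      p E = Real.exp (-(γ + η * (1 - q x) + η / n * ∑ k, q (E k))) := fun E => by
    rw [hp, ← Real.exp_add]
    ring_nf
  have hsum : 0 ≤ ∑ k, q (D' k) := Finset.sum_nonneg fun k _ => (hq _).1
  have hlower : γ ≤ γ + η * (1 - q x) + η / n * ∑ k, q (D' k) := by
    have hx : 0 ≤ η * (1 - q x) := mul_nonneg hη.le (by linarith [(hq x).2])
    have hD' : 0 ≤ η / n * ∑ k, q (D' k) := by positivity
    linarith
  have hDD' : η / n * ∑ k, q (D k) ≤ η / n * (∑ k, q (D' k) + 1) := by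
    gcongr
    exact sum_comp_le_sum_comp_add_one_of_eq_off_index hq hi
  have hD'D : η / n * ∑ k, q (D' k) ≤ η / n * (∑ k, q (D k) + 1) := by
    gcongr
    exact sum_comp_le_sum_comp_add_one_of_eq_off_index hq fun j hj => (hi j hj).symm
  rw [hpu D, hpu D']
  constructor
  · rw [← Real.exp_add, Real.exp_le_exp]
    linarith
  · exact one_sub_exp_neg_le_exp_mul hε0 hεγ hlower (by linarith) (hγ.le.trans hlower)
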